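/- Let 1 ≤ i ≤ d, r_i ∈ ℕ* and let ℓ_i ∈ W²_{r_i}(q_i) with ∫_0^1 ℓ_i q_i = 0. Let ℓ_{i,m_i} be the orthogonal projection of ℓ_i in L^2(q_i) onto the span of (φ_{i,k}, 0 ≤ k ≤ m_i), with m_i + 1 ≥ r_i. Then ‖ℓ_i - ℓ_{i,m_i}‖²_{L²(q_i)} ≤ 2^{-2r_i} ((m_i+1-r_i)! (m_i+d)!) / ((m_i+1)! (m_i+d+r_i)!) · ‖ℓ_i^{(r_i)}‖²_{L²(q_i)}. -/

import Mathlib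

open MeasureTheory Real

def simplexD (d : ℕ) : Set (Fin d → ℝ) :=
  {x | (∀ i, x i ∈ Set.Icc (0:ℝ) 1) ∧ ∀ i j : Fin d, i ≤ j → x i ≤ x j}

noncomputable def qMeas (d i : ℕ) : Measure ℝ :=
  volume.withDensity (fun t => ENNReal.ofReal
    (Set.indicator (Set.Icc (0:ℝ) 1)
      (fun s => (1-s)^(d-i) * s^(i-1) / ((d-i).factorial * (i-1).factorial)) t))

noncomputable def jacobiP (a b k : ℕ) (t : ℝ) : ℝ :=
  (-1)^k / ((2:ℝ)^k * (k.factorial : ℝ) * ((1-t)^a * (1+t)^b)) *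
    iteratedDeriv k (fun s => (1-s)^a * (1+s)^b * (1-s^2)^k) t

noncomputable def phiB (d i k : ℕ) (t : ℝ) : ℝ :=
  Real.sqrt ((((2*k+d) * k.factorial * (k+d-1).factorial : ℕ) : ℝ) /
      (((k+d-i).factorial * (k+i-1).factorial : ℕ) : ℝ)) *
  Real.sqrt (((d-i).factorial * (i-1).factorial : ℕ) : ℝ) *
  jacobiP (d-i) (i-1) k (2*t-1)


/-- Derivative of w_{a+1,b+1} p divided by w_{a,b}. -/
noncomputable def jT (a b : ℕ) (p : Polynomial ℝ) : Polynomial ℝ :=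
  Polynomial.X * (1 - Polynomial.X) * Polynomial.derivative p +
    (Polynomial.C ((b:ℝ)+1) - Polynomial.C ((a:ℝ)+b+2) * Polynomial.X) * p

/-- Unnormalised shifted Jacobi polynomials. -/
noncomputable def jJ : ℕ → ℕ → ℕ → Polynomial ℝ
  | _, _, 0 => 1
  | a, b, k+1 => jT a b (jJ (a+1) (b+1) k)

def jw (a b : ℕ) (t : ℝ) : ℝ := (1-t)^a * t^b

lemma jw_cont (a b : ℕ) : Continuous (jw a b) := by unfold jw; fun_prop

lemma jT_natDegree (a b n : ℕ) (p : Polynomial ℝ) (hp : p.natDegree ≤ n) :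
    (jT a b p).natDegree ≤ n + 1 := by
  unfold jT
  rw [Polynomial.natDegree_le_iff_coeff_eq_zero] at *
  intro N hN
  obtain ⟨M, rfl⟩ : ∃ M, N = M + 2 := ⟨N - 2, by omega⟩
  have e : Polynomial.X * (1 - Polynomial.X) * Polynomial.derivative p +
      (Polynomial.C ((b:ℝ)+1) - Polynomial.C ((a:ℝ)+b+2) * Polynomial.X) * p
      = Polynomial.derivative p * Polynomial.X
       - Polynomial.derivative p * Polynomial.X * Polynomial.X
       + Polynomial.C ((b:ℝ)+1) * p - Polynomial.C ((a:ℝ)+b+2) * (p * Polynomial.X) := by ring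
  rw [e]
  simp only [Polynomial.coeff_add, Polynomial.coeff_sub, Polynomial.coeff_C_mul,
    Polynomial.coeff_mul_X, Polynomial.coeff_derivative]
  rw [hp (M+1+1) (by omega), hp (M+1) (by omega)]
  simp

lemma jT_coeff (a b n : ℕ) (p : Polynomial ℝ) (hp : p.natDegree ≤ n) :
    (jT a b p).coeff (n+1) = -((n:ℝ)+a+b+2) * p.coeff n := by
  unfold jT
  rw [Polynomial.natDegree_le_iff_coeff_eq_zero] at hp
  have e : Polynomial.X * (1 - Polynomial.X) * Polynomial.derivative p +
      (Polynomial.C ((b:ℝ)+1) - Polynomial.C ((a:ℝ)+b+2) * Polynomial.X) * p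
      = Polynomial.derivative p * Polynomial.X
       - Polynomial.derivative p * Polynomial.X * Polynomial.X
       + Polynomial.C ((b:ℝ)+1) * p - Polynomial.C ((a:ℝ)+b+2) * (p * Polynomial.X) := by ring
  rw [e]
  cases n with
  | zero =>
    simp only [Polynomial.coeff_add, Polynomial.coeff_sub, Polynomial.coeff_C_mul,
    Polynomial.coeff_mul_X, Polynomial.coeff_derivative, hp 1 (by omega),
    Polynomial.mul_coeff_zero, Polynomial.coeff_X_zero]
    push_cast
    ring
  | succ n =>
    simp only [Polynomial.coeff_add, Polynomial.coeff_sub, Polynomial.coeff_C_mul,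
    Polynomial.coeff_mul_X, Polynomial.coeff_derivative]
    rw [hp (n+1+1) (by omega)]
    push_cast
    ring

lemma jJ_natDegree (k : ℕ) : ∀ a b : ℕ, (jJ a b k).natDegree ≤ k := by
  induction k with
  | zero => intro a b; simp [jJ]
  | succ k ih => intro a b; exact jT_natDegree _ _ _ _ (ih _ _)

lemma jJ_coeff (k : ℕ) : ∀ a b : ℕ,
    (jJ a b k).coeff k = (-1)^k * ((2*k+a+b).factorial : ℝ) / ((k+a+b).factorial : ℝ) := by
  induction k with
  | zero =>
    intro a b
    have := (Nat.cast_ne_zero (R := ℝ)).2 (Nat.factorial_ne_zero (a+b))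
    simp [jJ]
    field_simp
  | succ k ih =>
    intro a b
    rw [jJ, jT_coeff _ _ _ _ (jJ_natDegree _ _ _), ih]
    have e1 : 2*k+(a+1)+(b+1) = 2*(k+1)+a+b := by ring
    have e2 : k+(a+1)+(b+1) = (k+1+a+b)+1 := by ring
    rw [e1, e2, Nat.factorial_succ (k+1+a+b)]
    have := (Nat.cast_ne_zero (R := ℝ)).2 (Nat.factorial_ne_zero (k+1+a+b))
    have h3 : ((k:ℝ)+1+a+b+1) ≠ 0 := by positivity
    push_cast
    field_simp
    ring

lemma jw_hasDeriv (a b : ℕ) (p : Polynomial ℝ) (t : ℝ) :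
    HasDerivAt (fun s => jw (a+1) (b+1) s * p.eval s) (jw a b t * (jT a b p).eval t) t := by
  have h1 : HasDerivAt (fun s : ℝ => (1-s)^(a+1)) (((a+1:ℕ):ℝ) * (1-t)^a * (-1)) t := by
    simpa using ((hasDerivAt_id t).const_sub 1).fun_pow (a+1)
  have h2 : HasDerivAt (fun s : ℝ => s^(b+1)) (((b+1:ℕ):ℝ) * t^b) t := by
    simpa using (hasDerivAt_id t).fun_pow (b+1)
  have h := (h1.mul h2).mul (p.hasDerivAt t)
  refine h.congr_deriv ?_
  simp [jw, jT]
  ring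

/-- Integration by parts. -/
lemma jIBP (a b : ℕ) (p : Polynomial ℝ) (f : ℝ → ℝ) (hf : ContDiff ℝ 1 f) :
    ∫ t in (0:ℝ)..1, deriv f t * (p.eval t) * jw (a+1) (b+1) t
      = - ∫ t in (0:ℝ)..1, f t * (jT a b p).eval t * jw a b t := by
  have hd : Continuous (deriv f) := hf.continuous_deriv le_rfl
  have hc := hf.continuous
  have hw := jw_cont a b
  have hw' := jw_cont (a+1) (b+1)
  have hp := p.continuous
  have hp' := (jT a b p).continuous
  have key : ∫ t in (0:ℝ)..1, (deriv f t * (jw (a+1) (b+1) t * p.eval t)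
      + f t * (jw a b t * (jT a b p).eval t)) = 0 := by
    rw [intervalIntegral.integral_eq_sub_of_hasDerivAt
      (f := fun t => f t * (jw (a+1) (b+1) t * p.eval t))]
    · simp [jw]
    · intro t _
      exact ((hf.differentiable one_ne_zero) t).hasDerivAt.mul (jw_hasDeriv a b p t)
    · apply Continuous.intervalIntegrable
      fun_prop
  rw [intervalIntegral.integral_add] at key
  · rw [eq_neg_iff_add_eq_zero, ← key]
    congr 1 <;> (congr 1; ext t; ring)
  · apply Continuous.intervalIntegrable; fun_prop
  · apply Continuous.intervalIntegrable; fun_prop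

lemma jBeta (a : ℕ) : ∀ b : ℕ, ∫ t in (0:ℝ)..1, jw a b t
    = (a.factorial * b.factorial : ℝ) / ((a+b+1).factorial : ℝ) := by
  induction a with
  | zero =>
    intro b
    have h := (Nat.cast_ne_zero (R := ℝ)).2 (Nat.factorial_ne_zero b)
    simp [jw, Nat.factorial_succ]
    field_simp
  | succ a ih =>
    intro b
    have hw := jw_cont (a+1) b
    have hw' := jw_cont a (b+1)
    have key : ∫ t in (0:ℝ)..1, (((b:ℝ)+1) * jw (a+1) b t - ((a:ℝ)+1) * jw a (b+1) t) = 0 := by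
      rw [intervalIntegral.integral_eq_sub_of_hasDerivAt
        (f := fun t => jw (a+1) (b+1) t)]
      · simp [jw]
      · intro t _
        have := jw_hasDeriv a b 1 t
        simp only [Polynomial.eval_one, mul_one] at this
        refine this.congr_deriv ?_
        simp [jw, jT]
        ring
      · apply Continuous.intervalIntegrable
        fun_prop
    rw [intervalIntegral.integral_sub, intervalIntegral.integral_const_mul,
      intervalIntegral.integral_const_mul, ih] at key
    · have e : a + (b+1) + 1 = a + 1 + b + 1 := by ring
      rw [e, Nat.factorial_succ b] at key
      rw [Nat.factorial_succ a]
      have h := (Nat.cast_ne_zero (R := ℝ)).2 (Nat.factorial_ne_zero (a+1+b+1))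
      have h3 : ((b:ℝ)+1) ≠ 0 := by positivity
      apply mul_left_cancel₀ h3
      rw [sub_eq_zero.1 key]
      push_cast
      field_simp
    · apply Continuous.intervalIntegrable; fun_prop
    · apply Continuous.intervalIntegrable; fun_prop

lemma jOrth (k : ℕ) : ∀ (a b : ℕ) (q : Polynomial ℝ), q.natDegree ≤ k →
    ∫ t in (0:ℝ)..1, q.eval t * (jJ a b k).eval t * jw a b t
     = (-1)^k * q.coeff k * k.factorial *
      (((a+k).factorial * (b+k).factorial : ℝ) / ((a+b+2*k+1).factorial : ℝ)) := by
  induction k with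
  | zero =>
    intro a b q hq
    rw [Polynomial.eq_C_of_natDegree_le_zero hq]
    simp [jJ, jBeta]
  | succ k ih =>
    intro a b q hq
    have hi := jIBP a b (jJ (a+1) (b+1) k) (fun t => q.eval t)
      (by have h := q.contDiff_aeval (𝕜 := ℝ) 1; simp only [Polynomial.coe_aeval_eq_eval] at h; exact h)
    simp only [Polynomial.deriv] at hi
    rw [ih] at hi
    · rw [jJ, ← neg_eq_iff_eq_neg.2 hi, Polynomial.coeff_derivative, Nat.factorial_succ k]
      have e1 : a + 1 + k = a + (k+1) := by ring
      have e2 : b + 1 + k = b + (k+1) := by ring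
      have e3 : a + 1 + (b + 1) + 2 * k + 1 = a + b + 2*(k+1) + 1 := by ring
      rw [e1, e2, e3]
      push_cast
      ring
    · exact (Polynomial.natDegree_derivative_le q).trans (by omega)

noncomputable def jN (a b k : ℕ) : ℝ :=
  (k.factorial : ℝ) * (a+k).factorial * (b+k).factorial /
    (((k+a+b).factorial : ℝ) * (2*k+a+b+1))

lemma jN_pos (a b k : ℕ) : 0 < jN a b k := by unfold jN; positivity

lemma jJ_norm (a b k : ℕ) :
    ∫ t in (0:ℝ)..1, (jJ a b k).eval t * (jJ a b k).eval t * jw a b t = jN a b k := by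
  rw [jOrth k a b _ (jJ_natDegree k a b), jJ_coeff, jN]
  have e : a + b + 2*k + 1 = (2*k+a+b)+1 := by ring
  rw [e, Nat.factorial_succ]
  have h1 := (Nat.cast_ne_zero (R := ℝ)).2 (Nat.factorial_ne_zero (2*k+a+b))
  have h2 := (Nat.cast_ne_zero (R := ℝ)).2 (Nat.factorial_ne_zero (k+a+b))
  have h3 : (2*(k:ℝ)+a+b+1) ≠ 0 := by positivity
  have h4 : ((-1:ℝ)^k)^2 = 1 := by rw [← pow_mul, mul_comm, pow_mul]; simp
  push_cast
  field_simp
  rw [h4]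

lemma jJ_orth_lt (a b j k : ℕ) (h : j < k) :
    ∫ t in (0:ℝ)..1, (jJ a b j).eval t * (jJ a b k).eval t * jw a b t = 0 := by
  have hd := jJ_natDegree j a b
  rw [jOrth k a b _ (hd.trans h.le),
    Polynomial.coeff_eq_zero_of_natDegree_lt (hd.trans_lt h)]
  simp

/-- transfer of coefficients to derivatives -/
lemma jTransfer (r : ℕ) : ∀ (f : ℝ → ℝ), ContDiff ℝ r f → ∀ a b k : ℕ,
    ∫ t in (0:ℝ)..1, iteratedDeriv r f t * (jJ (a+r) (b+r) k).eval t * jw (a+r) (b+r) t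
     = (-1)^r * ∫ t in (0:ℝ)..1, f t * (jJ a b (k+r)).eval t * jw a b t := by
  induction r with
  | zero => intro f _ a b k; simp
  | succ r ih =>
    intro f hf a b k
    have hg : ContDiff ℝ 1 (iteratedDeriv r f) := by
      apply ContDiff.iterate_deriv' 1 r _ |> fun h => by rwa [iteratedDeriv_eq_iterate]
      rw [add_comm]; exact_mod_cast hf
    have hi := jIBP (a+r) (b+r) (jJ (a+r+1) (b+r+1) k) _ hg
    have h2 := ih f (hf.of_le (by exact_mod_cast Nat.le_succ r)) a b (k+1)
    rw [jJ] at h2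
    rw [h2] at hi
    rw [iteratedDeriv_succ, ← add_assoc, ← add_assoc, hi]
    have e : k + 1 + r = k + (r+1) := by ring
    rw [e]
    ring

lemma jw_rescale (k : ℕ) : ∀ a b : ℕ,
    iteratedDeriv k (fun s : ℝ => (1-s)^(a+k) * (1+s)^(b+k))
     = fun s => 2^k * (1-s)^a * (1+s)^b * (jJ a b k).eval ((s+1)/2) := by
  induction k with
  | zero => intro a b; simp [jJ]
  | succ k ih =>
    intro a b
    have h := ih (a+1) (b+1)
    have e1 : a + 1 + k = a + (k+1) := by ring
    have e2 : b + 1 + k = b + (k+1) := by ring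
    rw [e1, e2] at h
    rw [iteratedDeriv_succ, h]
    ext s
    have hh : HasDerivAt (fun s : ℝ => (s+1)/2) (1/2) s :=
      ((hasDerivAt_id s).add_const 1).div_const 2
    have h0 := (jw_hasDeriv a b (jJ (a+1) (b+1) k) ((s+1)/2)).comp s hh
    have h1 := h0.const_mul ((2:ℝ)^k * 2^(a+1) * 2^(b+1))
    have x1 : 1 - (s+1)/2 = (1-s)/2 := by ring
    refine (HasDerivAt.congr_deriv (h1.congr_of_eventuallyEq
      (Filter.Eventually.of_forall fun x => ?_)) ?_).deriv
    · have x1 : 1 - (x+1)/2 = (1-x)/2 := by ring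
      simp only [jw, Function.comp, x1, div_pow]
      field_simp
      ring
    · simp only [jw, x1, div_pow, jJ]
      field_simp
      ring

lemma jacobi_eq (a b k : ℕ) (t : ℝ) (h0 : 0 < t) (h1 : t < 1) :
    jacobiP a b k (2*t-1) = (-1)^k / (k.factorial : ℝ) * (jJ a b k).eval t := by
  have e : (fun s : ℝ => (1-s)^a * (1+s)^b * (1-s^2)^k)
      = fun s : ℝ => (1-s)^(a+k) * (1+s)^(b+k) := by
    ext s
    have : 1 - s^2 = (1-s)*(1+s) := by ring
    rw [this, mul_pow, pow_add, pow_add]; ring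
  have x1 : (2*t-1+1)/2 = t := by ring
  unfold jacobiP
  rw [e, jw_rescale]
  simp only [x1]
  have p1 : 1 - (2*t-1) ≠ 0 := by linarith
  have p2 : 1 + (2*t-1) ≠ 0 := by linarith
  have := (Nat.cast_ne_zero (R := ℝ)).2 (Nat.factorial_ne_zero k)
  field_simp

/-- weighted inner product on continuous functions -/
noncomputable def jB (a b : ℕ) : C(ℝ, ℝ) →ₗ[ℝ] C(ℝ, ℝ) →ₗ[ℝ] ℝ :=
  LinearMap.mk₂ ℝ (fun f g => ∫ t in (0:ℝ)..1, f t * g t * jw a b t)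
    (by
      intro f g h
      have hw := jw_cont a b
      rw [← intervalIntegral.integral_add]
      · congr 1; ext t; simp; ring
      · apply Continuous.intervalIntegrable; fun_prop
      · apply Continuous.intervalIntegrable; fun_prop)
    (by
      intro c f g
      rw [smul_eq_mul, ← intervalIntegral.integral_const_mul]
      congr 1; ext t; simp; ring)
    (by
      intro f g h
      have hw := jw_cont a b
      rw [← intervalIntegral.integral_add]
      · congr 1; ext t; simp; ring
      · apply Continuous.intervalIntegrable; fun_prop
      · apply Continuous.intervalIntegrable; fun_prop)
    (by
      intro c f g
      rw [smul_eq_mul, ← intervalIntegral.integral_const_mul]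
      congr 1; ext t; simp; ring)

lemma jB_apply (a b : ℕ) (f g : C(ℝ, ℝ)) :
    jB a b f g = ∫ t in (0:ℝ)..1, f t * g t * jw a b t := rfl

lemma jB_symm (a b : ℕ) (f g : C(ℝ, ℝ)) : jB a b f g = jB a b g f := by
  rw [jB_apply, jB_apply]; congr 1; ext t; ring

lemma jw_nonneg (a b : ℕ) (t : ℝ) (h : t ∈ Set.Icc (0:ℝ) 1) : 0 ≤ jw a b t := by
  have h1 : 0 ≤ 1 - t := by linarith [h.2]
  have h0 := h.1
  unfold jw; positivity

lemma jw_le_one (a b : ℕ) (t : ℝ) (h : t ∈ Set.Icc (0:ℝ) 1) : jw a b t ≤ 1 := by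
  have h1 : 0 ≤ 1 - t := by linarith [h.2]
  have h0 := h.1
  unfold jw
  exact mul_le_one₀ (pow_le_one₀ h1 (by linarith)) (by positivity) (pow_le_one₀ h0 h.2)

lemma jB_nonneg (a b : ℕ) (f : C(ℝ, ℝ)) : 0 ≤ jB a b f f := by
  rw [jB_apply]
  apply intervalIntegral.integral_nonneg zero_le_one
  intro t ht
  exact mul_nonneg (mul_self_nonneg _) (jw_nonneg a b t ht)

noncomputable def jE (a b k : ℕ) : C(ℝ, ℝ) := Polynomial.toContinuousMapAlgHom (jJ a b k)

lemma jB_orth (a b j k : ℕ) : jB a b (jE a b j) (jE a b k) = if j = k then jN a b k else 0 := by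
  split_ifs with h
  · subst h; exact jJ_norm a b j
  · rcases lt_or_gt_of_ne h with h | h
    · exact jJ_orth_lt a b j k h
    · rw [jB_symm]; exact jJ_orth_lt a b k j h

noncomputable def jS (a b N : ℕ) (f : C(ℝ, ℝ)) : C(ℝ, ℝ) :=
  ∑ k ∈ Finset.range N, (jB a b f (jE a b k) / jN a b k) • jE a b k

lemma jB_S_E (a b N k : ℕ) (f : C(ℝ, ℝ)) (hk : k < N) :
    jB a b (jS a b N f) (jE a b k) = jB a b f (jE a b k) := by
  have := (jN_pos a b k).ne'
  simp only [jS, map_sum, map_smul, LinearMap.sum_apply, LinearMap.smul_apply, jB_orth, smul_eq_mul,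
    mul_ite, mul_zero, Finset.sum_ite_eq', Finset.mem_range, hk, if_true]
  field_simp

lemma jPyth (a b N : ℕ) (f : C(ℝ, ℝ)) :
    jB a b (f - jS a b N f) (f - jS a b N f)
      = jB a b f f - ∑ k ∈ Finset.range N, (jB a b f (jE a b k))^2 / jN a b k := by
  have h1 : jB a b (f - jS a b N f) (jS a b N f) = 0 := by
    conv_lhs => enter [2]; rw [jS]
    rw [map_sum]
    apply Finset.sum_eq_zero
    intro k hk
    rw [map_smul, map_sub, LinearMap.sub_apply, jB_S_E _ _ _ _ _ (Finset.mem_range.1 hk)]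
    simp
  rw [map_sub (jB a b (f - jS a b N f)), h1, sub_zero, map_sub, LinearMap.sub_apply]
  congr 1
  rw [jS, map_sum, LinearMap.sum_apply]
  apply Finset.sum_congr rfl
  intro k _
  rw [map_smul, LinearMap.smul_apply, jB_symm a b (jE a b k) f, smul_eq_mul]
  ring

lemma jS_poly (a b N : ℕ) (q : Polynomial ℝ) (hq : q.natDegree < N) :
    jS a b N (Polynomial.toContinuousMapAlgHom q) = Polynomial.toContinuousMapAlgHom q := by
  set Q : C(ℝ, ℝ) := Polynomial.toContinuousMapAlgHom q with hQ
  set p : Polynomial ℝ := q - ∑ k ∈ Finset.range N, (jB a b Q (jE a b k) / jN a b k) • jJ a b k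
    with hp
  have hpe : Polynomial.toContinuousMapAlgHom p = Q - jS a b N Q := by
    rw [hp, map_sub, map_sum, jS]
    congr 1
    apply Finset.sum_congr rfl
    intro k _
    rw [map_smul]; rfl
  have hdeg : p.natDegree < N := by
    have hN : 0 < N := by omega
    have : p.natDegree ≤ N - 1 := by
      rw [hp, ← max_self (N-1)]
      apply Polynomial.natDegree_sub_le_of_le (by omega)
      apply Polynomial.natDegree_sum_le_of_forall_le
      intro k hk
      have := Finset.mem_range.1 hk
      exact (Polynomial.natDegree_smul_le _ _).trans ((jJ_natDegree k a b).trans (by omega))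
    omega
  have h0 : jB a b (Polynomial.toContinuousMapAlgHom p) (jE a b p.natDegree) = 0 := by
    rw [hpe, map_sub, LinearMap.sub_apply, jB_S_E _ _ _ _ _ hdeg, sub_self]
  have h1 := jOrth p.natDegree a b p le_rfl
  have h2 : jB a b (Polynomial.toContinuousMapAlgHom p) (jE a b p.natDegree) =
    ∫ t in (0:ℝ)..1, p.eval t * (jJ a b p.natDegree).eval t * jw a b t := rfl
  rw [← h2, h0] at h1
  have hp0 : p = 0 := by
    by_contra hne
    have hl : p.coeff p.natDegree ≠ 0 := by
      simpa using hne
    revert h1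
    apply Ne.symm
    have f1 := (Nat.cast_ne_zero (R := ℝ)).2 (Nat.factorial_ne_zero p.natDegree)
    have f2 := (Nat.cast_ne_zero (R := ℝ)).2 (Nat.factorial_ne_zero (a+p.natDegree))
    have f3 := (Nat.cast_ne_zero (R := ℝ)).2 (Nat.factorial_ne_zero (b+p.natDegree))
    have f4 := (Nat.cast_ne_zero (R := ℝ)).2 (Nat.factorial_ne_zero (a+b+2*p.natDegree+1))
    have f5 : ((-1:ℝ)^p.natDegree) ≠ 0 := by positivity
    exact mul_ne_zero (mul_ne_zero (mul_ne_zero f5 hl) f1) (div_ne_zero (mul_ne_zero f2 f3) f4)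
  rw [hp0, map_zero] at hpe
  exact (sub_eq_zero.1 hpe.symm).symm

lemma jDense (a b m : ℕ) (f : C(ℝ, ℝ)) (ε : ℝ) (hε : 0 < ε) :
    ∃ N, m ≤ N ∧ jB a b (f - jS a b N f) (f - jS a b N f) ≤ ε := by
  obtain ⟨q, hq⟩ := exists_polynomial_near_of_continuousOn 0 1 f f.continuous.continuousOn
    (√ε) (Real.sqrt_pos.2 hε)
  refine ⟨max m (q.natDegree + 1), le_max_left _ _, ?_⟩
  set N := max m (q.natDegree + 1)
  set Q : C(ℝ, ℝ) := Polynomial.toContinuousMapAlgHom q with hQ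
  have hs : jS a b N Q = Q := jS_poly a b N q (by omega)
  have hsub : jS a b N (f - Q) = jS a b N f - Q := by
    conv_rhs => rw [← hs]
    simp only [jS, map_sub, LinearMap.sub_apply, sub_div, sub_smul, Finset.sum_sub_distrib]
  have e : f - jS a b N f = (f - Q) - jS a b N (f - Q) := by rw [hsub]; abel
  rw [e, jPyth]
  have hpos : 0 ≤ ∑ k ∈ Finset.range N, (jB a b (f - Q) (jE a b k))^2 / jN a b k :=
    Finset.sum_nonneg fun k _ => div_nonneg (sq_nonneg _) (jN_pos a b k).le
  have hle : jB a b (f - Q) (f - Q) ≤ ε := by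
    rw [jB_apply]
    have hw := jw_cont a b
    calc _ ≤ ∫ t in (0:ℝ)..1, ε := by
          apply intervalIntegral.integral_mono_on zero_le_one
          · apply Continuous.intervalIntegrable; fun_prop
          · simp
          · intro t ht
            have h1 := hq t ht
            have h2 : (f - Q) t * (f - Q) t ≤ ε := by
              have : (f - Q) t = -(q.eval t - f t) := by
                simp [hQ]
              rw [this, neg_mul_neg, ← abs_mul_abs_self]
              calc _ ≤ √ε * √ε := by gcongr
                _ = ε := Real.mul_self_sqrt hε.le
            calc _ ≤ (f - Q) t * (f - Q) t * 1 := by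
                  gcongr
                  · exact mul_self_nonneg _
                  · exact jw_le_one a b t ht
              _ ≤ ε := by linarith
      _ = ε := by simp
  linarith

noncomputable def jR (s r k : ℕ) : ℝ :=
  (((k-r).factorial * (k+s).factorial : ℕ) : ℝ) / ((k.factorial * (k+s+r).factorial : ℕ) : ℝ)

lemma jR_anti (s r k m : ℕ) (hr : r ≤ m) (hk : m ≤ k) : jR s r k ≤ jR s r m := by
  induction k, hk using Nat.le_induction with
  | base => exact le_rfl
  | succ k hk ih =>
    refine le_trans ?_ ih
    obtain ⟨n, rfl⟩ : ∃ n, k = n + r := ⟨k - r, by omega⟩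
    unfold jR
    have e1 : n + r + 1 - r = n + 1 := by omega
    have e2 : n + r - r = n := by omega
    have e3 : n + r + 1 + s = (n + r + s) + 1 := by ring
    have e4 : n + r + s + 1 + r = (n + r + s + r) + 1 := by ring
    rw [e1, e2, e3, e4, div_le_div_iff₀ (by positivity) (by positivity)]
    norm_cast
    simp only [Nat.factorial_succ]
    calc _ = (n.factorial * (n+r+s).factorial * (n+r).factorial * (n+r+s+r).factorial)
          * ((n+1) * (n+r+s+1)) := by ring
      _ ≤ (n.factorial * (n+r+s).factorial * (n+r).factorial * (n+r+s+r).factorial)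
          * ((n+r+1) * (n+r+s+r+1)) := by
            apply Nat.mul_le_mul_left
            apply Nat.mul_le_mul <;> omega
      _ = _ := by ring

lemma jN_ratio (a b r n : ℕ) : jN (a+r) (b+r) n = jR (a+b) r (n+r) * jN a b (n+r) := by
  unfold jN jR
  have e1 : n + r - r = n := by omega
  have e2 : a + r + n = a + (n + r) := by ring
  have e3 : b + r + n = b + (n + r) := by ring
  have e4 : n + (a+r) + (b+r) = n + r + (a+b) + r := by ring
  have e5 : n + r + a + b = n + r + (a+b) := by ring
  rw [e1, e2, e3, e4, e5]
  have f1 := (Nat.cast_ne_zero (R := ℝ)).2 (Nat.factorial_ne_zero (n+r))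
  have f2 := (Nat.cast_ne_zero (R := ℝ)).2 (Nat.factorial_ne_zero (n+r+(a+b)))
  have f3 := (Nat.cast_ne_zero (R := ℝ)).2 (Nat.factorial_ne_zero (n+r+(a+b)+r))
  have h3 : (2*((n:ℝ)+r)+a+b+1) ≠ 0 := by positivity
  have h4 : (2*(n:ℝ)+(a+r)+(b+r)+1) ≠ 0 := by positivity
  push_cast
  field_simp
  ring

lemma jMain (a b r m : ℕ) (hr : r ≤ m) (f : C(ℝ, ℝ)) (hf : ContDiff ℝ r f) (g : C(ℝ, ℝ))
    (hg : ∀ t, g t = iteratedDeriv r f t) :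
    jB a b (f - jS a b m f) (f - jS a b m f) ≤ jR (a+b) r m * jB (a+r) (b+r) g g := by
  apply le_of_forall_pos_le_add
  intro ε hε
  obtain ⟨N, hN, h1⟩ := jDense a b m f ε hε
  rw [jPyth] at h1 ⊢
  have hRpos : 0 ≤ jR (a+b) r m := by unfold jR; positivity
  have h2 := jB_nonneg (a+r) (b+r) (g - jS (a+r) (b+r) (N-r) g)
  rw [jPyth] at h2
  have h3 := Finset.sum_range_add_sum_Ico
    (fun k => (jB a b f (jE a b k))^2 / jN a b k) hN
  have h4 : ∑ k ∈ Finset.Ico m N, (jB a b f (jE a b k))^2 / jN a b k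
      ≤ jR (a+b) r m * ∑ k ∈ Finset.range (N-r),
        (jB (a+r) (b+r) g (jE (a+r) (b+r) k))^2 / jN (a+r) (b+r) k := by
    have hsum : ∑ k ∈ Finset.range (N-r),
        (jB (a+r) (b+r) g (jE (a+r) (b+r) k))^2 / jN (a+r) (b+r) k
        = ∑ k ∈ Finset.Ico r N, (jB a b f (jE a b k))^2 / (jR (a+b) r k * jN a b k) := by
      rw [Finset.sum_Ico_eq_sum_range]
      apply Finset.sum_congr rfl
      intro k _
      rw [jN_ratio, add_comm r k]
      congr 1
      have ht := jTransfer r f hf a b k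
      have e1 : jB (a+r) (b+r) g (jE (a+r) (b+r) k) = (-1)^r * jB a b f (jE a b (k+r)) := by
        rw [jB_apply]
        simp only [hg]
        exact ht
      rw [e1, mul_pow, ← pow_mul, mul_comm r 2, pow_mul]
      simp
    rw [hsum, Finset.mul_sum]
    have hsub : Finset.Ico m N ⊆ Finset.Ico r N := Finset.Ico_subset_Ico hr le_rfl
    refine le_trans (Finset.sum_le_sum ?_) (Finset.sum_le_sum_of_subset_of_nonneg hsub ?_)
    · intro k hk
      have hk' := Finset.mem_Ico.1 hk
      have hRk : 0 < jR (a+b) r k := by unfold jR; positivity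
      have hNk := jN_pos a b k
      rw [← mul_div_assoc, div_le_div_iff₀ hNk (by positivity)]
      have := jR_anti (a+b) r k m hr hk'.1
      nlinarith [mul_le_mul_of_nonneg_left this
        (mul_nonneg (sq_nonneg (jB a b f (jE a b k))) hNk.le)]
    · intro k _ _
      have hRk : 0 < jR (a+b) r k := by unfold jR; positivity
      have hNk := jN_pos a b k
      positivity
  have h5 := mul_nonneg hRpos h2
  rw [mul_sub] at h5
  linarith

lemma jB_shift (a b r : ℕ) (g : C(ℝ, ℝ)) :
    jB (a+r) (b+r) g g ≤ ((2:ℝ)^(2*r))⁻¹ * jB a b g g := by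
  rw [jB_apply, jB_apply, ← intervalIntegral.integral_const_mul]
  have hw := jw_cont a b
  have hw' := jw_cont (a+r) (b+r)
  apply intervalIntegral.integral_mono_on zero_le_one
  · apply Continuous.intervalIntegrable; fun_prop
  · apply Continuous.intervalIntegrable; fun_prop
  · intro t ht
    have e : jw (a+r) (b+r) t = jw a b t * ((1-t)*t)^r := by unfold jw; rw [mul_pow]; ring
    have h0 : 0 ≤ (1-t)*t := mul_nonneg (by linarith [ht.2]) ht.1
    have h1 : ((1-t)*t)^r ≤ ((2:ℝ)^(2*r))⁻¹ := by
      rw [pow_mul, ← inv_pow]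
      apply pow_le_pow_left₀ h0
      norm_num
      nlinarith [sq_nonneg (2*t-1)]
    have h2 := mul_nonneg (mul_self_nonneg (g t)) (jw_nonneg a b t ht)
    rw [e]
    calc _ = (g t * g t * jw a b t) * ((1-t)*t)^r := by ring
      _ ≤ (g t * g t * jw a b t) * ((2:ℝ)^(2*r))⁻¹ := by gcongr
      _ = _ := by ring

lemma q_int (d i : ℕ) (g h : ℝ → ℝ) (hgh : ∀ t, 0 < t → t < 1 → g t = h t) :
    ∫ t, g t ∂(qMeas d i) = (((d-i).factorial * (i-1).factorial : ℝ))⁻¹ *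
      ∫ t in (0:ℝ)..1, h t * jw (d-i) (i-1) t := by
  unfold qMeas
  rw [integral_withDensity_eq_integral_toReal_smul]
  · rw [intervalIntegral.integral_of_le zero_le_one, integral_Ioc_eq_integral_Ioo,
      ← integral_Icc_eq_integral_Ioo, ← integral_const_mul,
      ← integral_indicator measurableSet_Icc]
    have h01 : ∀ᵐ t : ℝ, t ≠ 0 ∧ t ≠ 1 := by
      simp [Filter.eventually_and, Measure.ae_ne]
    apply integral_congr_ae
    filter_upwards [h01] with t ht
    by_cases hI : t ∈ Set.Icc (0:ℝ) 1
    · have hw := jw_nonneg (d-i) (i-1) t hI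
      rw [Set.indicator_of_mem hI, Set.indicator_of_mem hI, ENNReal.toReal_ofReal,
        hgh t (lt_of_le_of_ne hI.1 ht.1.symm) (lt_of_le_of_ne hI.2 ht.2)]
      · simp only [jw, smul_eq_mul]; ring
      · unfold jw at hw; positivity
    · rw [Set.indicator_of_notMem hI, Set.indicator_of_notMem hI]; simp
  · apply Measurable.ennreal_ofReal
    apply Measurable.indicator _ measurableSet_Icc
    fun_prop
  · simp

lemma phi_eq (d i k : ℕ) (t : ℝ) (h0 : 0 < t) (h1 : t < 1) :
    phiB d i k t = (Real.sqrt ((((2*k+d) * k.factorial * (k+d-1).factorial : ℕ) : ℝ) /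
      (((k+d-i).factorial * (k+i-1).factorial : ℕ) : ℝ)) *
      Real.sqrt (((d-i).factorial * (i-1).factorial : ℕ) : ℝ) *
      ((-1)^k / (k.factorial : ℝ))) * jE (d-i) (i-1) k t := by
  unfold phiB
  rw [jacobi_eq _ _ _ _ h0 h1]
  have : jE (d-i) (i-1) k t = (jJ (d-i) (i-1) k).eval t := rfl
  rw [this]; ring

lemma phi_const (d i k : ℕ) (h1 : 1 ≤ i) (h2 : i ≤ d) :
    (Real.sqrt ((((2*k+d) * k.factorial * (k+d-1).factorial : ℕ) : ℝ) /
      (((k+d-i).factorial * (k+i-1).factorial : ℕ) : ℝ)) *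
      Real.sqrt (((d-i).factorial * (i-1).factorial : ℕ) : ℝ) *
      ((-1)^k / (k.factorial : ℝ)))^2 * (((d-i).factorial * (i-1).factorial : ℝ))⁻¹
      = (jN (d-i) (i-1) k)⁻¹ := by
  rw [mul_pow, mul_pow, Real.sq_sqrt (by positivity), Real.sq_sqrt (by positivity), div_pow,
    ← pow_mul, mul_comm k 2, pow_mul]
  obtain ⟨b, rfl⟩ : ∃ b, i = b + 1 := ⟨i - 1, by omega⟩
  obtain ⟨a, rfl⟩ : ∃ a, d = a + (b + 1) := ⟨d - (b+1), by omega⟩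
  have e1 : a + (b+1) - (b+1) = a := by omega
  have e2 : b + 1 - 1 = b := by omega
  have e3 : k + (a + (b+1)) - 1 = k + a + b := by omega
  have e4 : k + (a + (b+1)) - (b+1) = a + k := by omega
  have e5 : k + (b+1) - 1 = b + k := by omega
  rw [e1, e2, e3, e4, e5, jN]
  have f1 := (Nat.cast_ne_zero (R := ℝ)).2 (Nat.factorial_ne_zero k)
  have f2 := (Nat.cast_ne_zero (R := ℝ)).2 (Nat.factorial_ne_zero a)
  have f3 := (Nat.cast_ne_zero (R := ℝ)).2 (Nat.factorial_ne_zero b)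
  have f4 := (Nat.cast_ne_zero (R := ℝ)).2 (Nat.factorial_ne_zero (a+k))
  have f5 := (Nat.cast_ne_zero (R := ℝ)).2 (Nat.factorial_ne_zero (b+k))
  have f6 := (Nat.cast_ne_zero (R := ℝ)).2 (Nat.factorial_ne_zero (k+a+b))
  have h3 : (2*(k:ℝ)+a+b+1) ≠ 0 := by positivity
  push_cast
  field_simp
  ring

/-- L²(q_i) bound on the projection error for Sobolev-smooth functions. -/
theorem statement18 (d i r mi : ℕ) (hd : 2 ≤ d) (h1 : 1 ≤ i) (h2 : i ≤ d)
    (hr : 1 ≤ r) (hm : r ≤ mi + 1)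
    (ℓ : ℝ → ℝ) (hsm : ContDiff ℝ r ℓ) (hcent : ∫ t, ℓ t ∂(qMeas d i) = 0)
    (P : ℝ → ℝ)
    (hP : ∀ t, P t = ∑ k ∈ Finset.range (mi+1),
      (∫ s, ℓ s * phiB d i k s ∂(qMeas d i)) * phiB d i k t) :
    ∫ t, (ℓ t - P t)^2 ∂(qMeas d i)
      ≤ ((2:ℝ)^(2*r))⁻¹ *
        ((((mi+1-r).factorial * (mi+d).factorial : ℕ) : ℝ) /
          (((mi+1).factorial * (mi+d+r).factorial : ℕ) : ℝ)) *
        ∫ t, (iteratedDeriv r ℓ t)^2 ∂(qMeas d i) := by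
  set a := d - i with ha
  set b := i - 1 with hb
  let f : C(ℝ, ℝ) := ⟨ℓ, hsm.continuous⟩
  let g : C(ℝ, ℝ) := ⟨iteratedDeriv r ℓ, hsm.continuous_iteratedDeriv r le_rfl⟩
  have hPS : ∀ t, 0 < t → t < 1 → P t = jS a b (mi+1) f t := by
    intro t h0 h1'
    rw [hP, jS, ContinuousMap.sum_apply]
    apply Finset.sum_congr rfl
    intro k _
    have hc := phi_const d i k h1 h2
    set c := (Real.sqrt ((((2*k+d) * k.factorial * (k+d-1).factorial : ℕ) : ℝ) /
      (((k+d-i).factorial * (k+i-1).factorial : ℕ) : ℝ)) *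
      Real.sqrt (((d-i).factorial * (i-1).factorial : ℕ) : ℝ) *
      ((-1)^k / (k.factorial : ℝ)))
    have hi := q_int d i (fun s => ℓ s * phiB d i k s) (fun s => c * (f s * jE a b k s)) (by
      intro s hs0 hs1
      rw [phi_eq d i k s hs0 hs1]
      change ℓ s * (c * jE a b k s) = c * (ℓ s * jE a b k s)
      ring)
    rw [hi, phi_eq d i k t h0 h1']
    have e : ∫ s in (0:ℝ)..1, c * (f s * jE a b k s) * jw (d-i) (i-1) s
        = c * jB a b f (jE a b k) := by
      rw [jB_apply, ← intervalIntegral.integral_const_mul]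
      congr 1; ext s; ring
    rw [e]
    change _ * (c * jE a b k t) = _
    rw [ContinuousMap.smul_apply, smul_eq_mul, div_eq_mul_inv, ← hc]
    ring
  have hL := q_int d i (fun t => (ℓ t - P t)^2)
    (fun t => (f - jS a b (mi+1) f) t * (f - jS a b (mi+1) f) t) (by
      intro t h0 h1'
      simp only [hPS t h0 h1', ContinuousMap.sub_apply, sq]
      rfl)
  have hR := q_int d i (fun t => (iteratedDeriv r ℓ t)^2) (fun t => g t * g t) (by
      intro t _ _
      exact sq _)
  rw [hL, hR]
  change _ * jB a b _ _ ≤ _ * (_ * jB a b g g)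
  have hm1 := jMain a b r (mi+1) hm f hsm g (fun _ => rfl)
  have hm2 := jB_shift a b r g
  have hRe : jR (a+b) r (mi+1) = (((mi+1-r).factorial * (mi+d).factorial : ℕ) : ℝ) /
          (((mi+1).factorial * (mi+d+r).factorial : ℕ) : ℝ) := by
    unfold jR
    have e1 : mi + 1 + (a+b) = mi + d := by omega
    rw [e1]
  rw [← hRe]
  have hRpos : 0 ≤ jR (a+b) r (mi+1) := by unfold jR; positivity
  have hm3 := hm1.trans (mul_le_mul_of_nonneg_left hm2 hRpos)
  have hK : 0 ≤ (((d-i).factorial * (i-1).factorial : ℝ))⁻¹ := by positivity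
  refine (mul_le_mul_of_nonneg_left hm3 hK).trans (le_of_eq ?_)
  ring
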